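/- For all n ≥ 2, m ≥ 0 and pairwise distinct general atoms R₁,…,R_m, S₁,…,Sₙ, T, the formula (R₁∧…∧R_m∧S₁ → T) ∧ … ∧ (R₁∧…∧R_m∧Sₙ → T) → (R₁∧…∧R_m∧(S₁⊔…⊔Sₙ) → T) is provable in CL2. -/

import Mathlib

/-- CL2-formulas: logical atoms ⊤/⊥, elementary atoms, general atoms,
negation, n-ary ∧, ∨, ⊓, ⊔ (arities other than ≥2 never arise in derivations
of proper formulas). -/
inductive CL2 : Type where
  | top : CL2
  | bot : CL2
  | elem : Nat → CL2
  | gen : Nat → CL2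
  | neg : CL2 → CL2
  | land : List CL2 → CL2
  | lor : List CL2 → CL2
  | chand : List CL2 → CL2
  | chor : List CL2 → CL2

namespace CL2

/-- Elementarization (with a polarity parameter): surface ⊓ becomes ⊤, surface ⊔
becomes ⊥, positive surface general atoms become ⊥, negative ones ⊤. -/
def elz (pos : Bool) : CL2 → CL2
  | top => top
  | bot => bot
  | elem n => elem n
  | gen _ => if pos then bot else top
  | neg F => neg (elz (!pos) F)
  | land l => land (l.attach.map (fun x => elz pos x.1))
  | lor l => lor (l.attach.map (fun x => elz pos x.1))
  | chand _ => top
  | chor _ => bot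
termination_by F => sizeOf F
decreasing_by
  all_goals simp_wf
  all_goals first
    | omega
    | (have h := List.sizeOf_lt_of_mem x.2; omega)

/-- Classical evaluation (used on elementarizations, which contain no
general atoms and no ⊓/⊔). -/
def eval (v : Nat → Bool) : CL2 → Bool
  | top => true
  | bot => false
  | elem n => v n
  | gen _ => false
  | neg F => !(eval v F)
  | land l => (l.attach.map (fun x => eval v x.1)).all id
  | lor l => (l.attach.map (fun x => eval v x.1)).any id
  | chand _ => true
  | chor _ => false
termination_by F => sizeOf F
decreasing_by
  all_goals simp_wf
  all_goals first
    | omega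
    | (have h := List.sizeOf_lt_of_mem x.2; omega)

/-- F is stable iff its elementarization is a classical tautology. -/
def Stable (F : CL2) : Prop := ∀ v : Nat → Bool, eval v (elz true F) = true

/-- Whether the elementary atom `p` occurs (anywhere) in a formula. -/
def elemOccurs (p : Nat) : CL2 → Bool
  | top => false
  | bot => false
  | elem n => n == p
  | gen _ => false
  | neg F => elemOccurs p F
  | land l => (l.attach.map (fun x => elemOccurs p x.1)).any id
  | lor l => (l.attach.map (fun x => elemOccurs p x.1)).any id
  | chand l => (l.attach.map (fun x => elemOccurs p x.1)).any id
  | chor l => (l.attach.map (fun x => elemOccurs p x.1)).any id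
termination_by F => sizeOf F
decreasing_by
  all_goals simp_wf
  all_goals first
    | omega
    | (have h := List.sizeOf_lt_of_mem x.2; omega)

end CL2

/-- One-hole surface contexts: the hole is not in the scope of ⊓ or ⊔. -/
inductive SCtx : Type where
  | hole : SCtx
  | neg : SCtx → SCtx
  | land : List CL2 → SCtx → List CL2 → SCtx
  | lor : List CL2 → SCtx → List CL2 → SCtx

namespace SCtx

def fill : SCtx → CL2 → CL2
  | hole, F => F
  | neg C, F => CL2.neg (fill C F)
  | land l C r, F => CL2.land (l ++ fill C F :: r)
  | lor l C r, F => CL2.lor (l ++ fill C F :: r)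

/-- Number of negations the hole is in the scope of. -/
def negCount : SCtx → Nat
  | hole => 0
  | neg C => negCount C + 1
  | land _ C _ => negCount C
  | lor _ C _ => negCount C

end SCtx

/-- Two-hole surface contexts (the two holes are distinct surface occurrences,
so their least common ancestor is an ∧- or ∨-node). -/
inductive DCtx : Type where
  | neg : DCtx → DCtx
  | land : List CL2 → DCtx → List CL2 → DCtx
  | lor : List CL2 → DCtx → List CL2 → DCtx
  | landS : List CL2 → SCtx → List CL2 → SCtx → List CL2 → DCtx
  | lorS : List CL2 → SCtx → List CL2 → SCtx → List CL2 → DCtx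

namespace DCtx

def fill2 : DCtx → CL2 → CL2 → CL2
  | neg D, A, B => CL2.neg (fill2 D A B)
  | land l D r, A, B => CL2.land (l ++ fill2 D A B :: r)
  | lor l D r, A, B => CL2.lor (l ++ fill2 D A B :: r)
  | landS l C1 m C2 r, A, B => CL2.land (l ++ C1.fill A :: m ++ C2.fill B :: r)
  | lorS l C1 m C2 r, A, B => CL2.lor (l ++ C1.fill A :: m ++ C2.fill B :: r)

def negCount1 : DCtx → Nat
  | neg D => negCount1 D + 1
  | land _ D _ => negCount1 D
  | lor _ D _ => negCount1 D
  | landS _ C1 _ _ _ => C1.negCount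
  | lorS _ C1 _ _ _ => C1.negCount

def negCount2 : DCtx → Nat
  | neg D => negCount2 D + 1
  | land _ D _ => negCount2 D
  | lor _ D _ => negCount2 D
  | landS _ _ _ C2 _ => C2.negCount
  | lorS _ _ _ C2 _ => C2.negCount

end DCtx

/-- The premises of Rule (a) with conclusion `F`: results of replacing a positive
surface occurrence of a ⊓-subformula, or a negative surface occurrence of a
⊔-subformula, by one of its components. -/
def PremiseA (F H : CL2) : Prop :=
  ∃ (C : SCtx) (Gs : List CL2) (i : Fin Gs.length),
    (Even C.negCount ∧ F = C.fill (CL2.chand Gs) ∧ H = C.fill (Gs.get i)) ∨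
    (Odd C.negCount ∧ F = C.fill (CL2.chor Gs) ∧ H = C.fill (Gs.get i))

/-- The premise of Rule (b): `H` results from replacing in `F` a negative surface
occurrence of a ⊓-subformula, or a positive surface occurrence of a ⊔-subformula,
by one of its components. -/
def PremiseB (F H : CL2) : Prop :=
  ∃ (C : SCtx) (Gs : List CL2) (i : Fin Gs.length),
    (Odd C.negCount ∧ F = C.fill (CL2.chand Gs) ∧ H = C.fill (Gs.get i)) ∨
    (Even C.negCount ∧ F = C.fill (CL2.chor Gs) ∧ H = C.fill (Gs.get i))

/-- The premise of Rule (c): `H` results from replacing in `F` two — one positive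
and one negative — surface occurrences of a general atom by an elementary atom
not occurring in `F`. -/
def PremiseC (F H : CL2) : Prop :=
  ∃ (D : DCtx) (P p : Nat),
    F = D.fill2 (CL2.gen P) (CL2.gen P) ∧
    H = D.fill2 (CL2.elem p) (CL2.elem p) ∧
    ((Even D.negCount1 ∧ Odd D.negCount2) ∨ (Odd D.negCount1 ∧ Even D.negCount2)) ∧
    CL2.elemOccurs p F = false

/-- CL2-provability. -/
inductive Provable : CL2 → Prop where
  | ruleA (F : CL2) : CL2.Stable F → (∀ H, PremiseA F H → Provable H) → Provable F
  | ruleB (F H : CL2) : PremiseB F H → Provable H → Provable F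
  | ruleC (F H : CL2) : PremiseC F H → Provable H → Provable F

/-- Implication: F → G abbreviates ¬F ∨ G. -/
def CL2.imp (F G : CL2) : CL2 := CL2.lor [CL2.neg F, G]

/-- `conjImp [F₁,…,Fₙ] T` is F₁∧…∧Fₙ → T, with the conventions that for n = 1 it
is F₁ → T and for n = 0 it is T. -/
def conjImp (l : List CL2) (t : CL2) : CL2 :=
  match l with
  | [] => t
  | [f] => CL2.imp f t
  | l => CL2.imp (CL2.land l) t

/-- `conj1 [F₁,…,Fₙ]` is F₁∧…∧Fₙ, with the convention that for n = 1 it is F₁. -/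
def conj1 (l : List CL2) : CL2 :=
  match l with
  | [f] => f
  | l => CL2.land l

namespace CL2

@[simp] theorem elz_land (b : Bool) (l : List CL2) : elz b (land l) = land (l.map (elz b)) := by
  simp [elz]

@[simp] theorem elz_lor (b : Bool) (l : List CL2) : elz b (lor l) = lor (l.map (elz b)) := by
  simp [elz]

@[simp] theorem eval_land (v : Nat → Bool) (l : List CL2) :
    eval v (land l) = l.all (eval v) := by
  simp [eval]

@[simp] theorem eval_lor (v : Nat → Bool) (l : List CL2) :
    eval v (lor l) = l.any (eval v) := by
  simp [eval]

theorem eval_elz_conj1 (v : Nat → Bool) (b : Bool) (l : List CL2) :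
    eval v (elz b (conj1 l)) = l.all (fun x => eval v (elz b x)) := by
  unfold conj1
  split <;> simp [Function.comp_def]

/-- Every formula contains only finitely many elementary atoms. -/
theorem exists_forall_ge_elemOccurs_eq_false (F : CL2) :
    ∃ N, ∀ p, N ≤ p → elemOccurs p F = false := by
  refine CL2.rec (motive_1 := fun F => ∃ N, ∀ p, N ≤ p → elemOccurs p F = false)
    (motive_2 := fun l => ∃ N, ∀ p, N ≤ p → ∀ x ∈ l, elemOccurs p x = false)
    ?_ ?_ ?_ ?_ ?_ ?_ ?_ ?_ ?_ ?_ ?_ F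
  · exact ⟨0, by simp [elemOccurs]⟩
  · exact ⟨0, by simp [elemOccurs]⟩
  · intro n
    exact ⟨n + 1, fun p hp => by simp [elemOccurs]; omega⟩
  · exact fun _ => ⟨0, by simp [elemOccurs]⟩
  · rintro F ⟨N, h⟩
    exact ⟨N, by simpa [elemOccurs] using h⟩
  iterate 4
    · rintro l ⟨N, h⟩
      exact ⟨N, by simpa [elemOccurs] using h⟩
  · exact ⟨0, by simp⟩
  · rintro x l ⟨N, hN⟩ ⟨M, hM⟩
    refine ⟨max N M, fun p hp y hy => ?_⟩
    rcases List.mem_cons.1 hy with rfl | hy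
    · exact hN p (by omega)
    · exact hM p (by omega) y hy

theorem exists_elemOccurs_eq_false (F : CL2) : ∃ p, elemOccurs p F = false :=
  let ⟨N, h⟩ := exists_forall_ge_elemOccurs_eq_false F
  ⟨N, h N le_rfl⟩

/-- The formula is a ⊓- or a ⊔-formula. -/
def IsChoice (F : CL2) : Prop := (∃ l, F = chand l) ∨ ∃ l, F = chor l

/-- The formula has no surface occurrence of a ⊓- or ⊔-subformula. -/
def ChoiceFree (F : CL2) : Prop := ∀ (C : SCtx) (X : CL2), X.IsChoice → F ≠ C.fill X

theorem choiceFree_gen (n : Nat) : ChoiceFree (gen n) := by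
  rintro (_ | _ | _ | _) X (⟨l, rfl⟩ | ⟨l, rfl⟩) h <;> simp [SCtx.fill] at h

theorem choiceFree_elem (n : Nat) : ChoiceFree (elem n) := by
  rintro (_ | _ | _ | _) X (⟨l, rfl⟩ | ⟨l, rfl⟩) h <;> simp [SCtx.fill] at h

theorem ChoiceFree.neg {F : CL2} (hF : F.ChoiceFree) : F.neg.ChoiceFree := by
  rintro (_ | C | _ | _) X hX h
  · rcases hX with ⟨l, rfl⟩ | ⟨l, rfl⟩ <;> simp [SCtx.fill] at h
  · exact hF C X hX (by simpa [SCtx.fill] using h)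
  all_goals simp [SCtx.fill] at h

theorem ChoiceFree.land {l : List CL2} (hl : ∀ F ∈ l, F.ChoiceFree) :
    (CL2.land l).ChoiceFree := by
  rintro (_ | _ | ⟨a, C, b⟩ | _) X hX h
  · rcases hX with ⟨l, rfl⟩ | ⟨l, rfl⟩ <;> simp [SCtx.fill] at h
  · simp [SCtx.fill] at h
  · simp only [SCtx.fill, land.injEq] at h
    exact hl (C.fill X) (by simp [h]) C X hX rfl
  · simp [SCtx.fill] at h

theorem ChoiceFree.lor {l : List CL2} (hl : ∀ F ∈ l, F.ChoiceFree) :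
    (CL2.lor l).ChoiceFree := by
  rintro (_ | _ | _ | ⟨a, C, b⟩) X hX h
  · rcases hX with ⟨l, rfl⟩ | ⟨l, rfl⟩ <;> simp [SCtx.fill] at h
  · simp [SCtx.fill] at h
  · simp [SCtx.fill] at h
  · simp only [SCtx.fill, lor.injEq] at h
    exact hl (C.fill X) (by simp [h]) C X hX rfl

theorem ChoiceFree.imp {F G : CL2} (hF : F.ChoiceFree) (hG : G.ChoiceFree) :
    (F.imp G).ChoiceFree :=
  ChoiceFree.lor (by simpa using ⟨hF.neg, hG⟩)

theorem ChoiceFree.conj1 {l : List CL2} (hl : ∀ F ∈ l, F.ChoiceFree) :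
    (conj1 l).ChoiceFree := by
  unfold _root_.conj1
  split
  · exact hl _ (by simp)
  · exact ChoiceFree.land hl

theorem ChoiceFree.not_premiseA {F H : CL2} (hF : F.ChoiceFree) : ¬ PremiseA F H := by
  rintro ⟨C, Gs, i, ⟨-, h, -⟩ | ⟨-, h, -⟩⟩
  · exact hF C _ (.inl ⟨_, rfl⟩) h
  · exact hF C _ (.inr ⟨_, rfl⟩) h

end CL2

theorem conjImp_append_singleton (l : List CL2) (a t : CL2) :
    conjImp (l ++ [a]) t = CL2.imp (conj1 (l ++ [a])) t := by
  rcases l with _ | ⟨x, _ | ⟨y, l⟩⟩ <;> rfl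

theorem List.append_cons_eq_append_cons_cases {α : Type*} {l r l' r' : List α} {a b : α}
    (h : l ++ a :: r = l' ++ b :: r') : (l = l' ∧ a = b ∧ r = r') ∨ b ∈ l ∨ b ∈ r := by
  rcases List.append_eq_append_iff.1 h with ⟨c, rfl, hc⟩ | ⟨c, rfl, hc⟩ <;>
    rcases c with _ | ⟨d, c⟩ <;> simp at hc <;> simp_all

namespace SCtx

/-- The formulas beside the path to the hole have no surface choice subformulas. -/
def ChoiceFree : SCtx → Prop
  | hole => True
  | neg C => C.ChoiceFree
  | land l C r => (∀ F ∈ l, F.ChoiceFree) ∧ C.ChoiceFree ∧ ∀ F ∈ r, F.ChoiceFree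
  | lor l C r => (∀ F ∈ l, F.ChoiceFree) ∧ C.ChoiceFree ∧ ∀ F ∈ r, F.ChoiceFree

/-- In a choice-free context, the hole is the only place of a surface choice subformula. -/
theorem ChoiceFree.fill_injective {K : SCtx} (hK : K.ChoiceFree) {C : SCtx} {X Y : CL2}
    (hX : X.IsChoice) (hY : Y.IsChoice) (h : K.fill Y = C.fill X) : C = K ∧ X = Y := by
  induction K generalizing C with
  | hole =>
    rcases hY with ⟨l, rfl⟩ | ⟨l, rfl⟩ <;> cases C <;> simp_all [fill]
  | neg K ih =>
    rcases C with _ | C | _ | _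
    · rcases hX with ⟨l, rfl⟩ | ⟨l, rfl⟩ <;> simp [fill] at h
    · simpa using ih hK (by simpa [fill] using h)
    all_goals simp [fill] at h
  | land l K r ih =>
    rcases C with _ | _ | ⟨l', C, r'⟩ | _
    · rcases hX with ⟨l, rfl⟩ | ⟨l, rfl⟩ <;> simp [fill] at h
    · simp [fill] at h
    · simp only [fill, CL2.land.injEq] at h
      rcases List.append_cons_eq_append_cons_cases h with ⟨rfl, hKC, rfl⟩ | h | h
      · simpa using ih hK.2.1 hKC
      · exact absurd rfl (hK.1 _ h C X hX)
      · exact absurd rfl (hK.2.2 _ h C X hX)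
    · simp [fill] at h
  | lor l K r ih =>
    rcases C with _ | _ | _ | ⟨l', C, r'⟩
    · rcases hX with ⟨l, rfl⟩ | ⟨l, rfl⟩ <;> simp [fill] at h
    · simp [fill] at h
    · simp [fill] at h
    · simp only [fill, CL2.lor.injEq] at h
      rcases List.append_cons_eq_append_cons_cases h with ⟨rfl, hKC, rfl⟩ | h | h
      · simpa using ih hK.2.1 hKC
      · exact absurd rfl (hK.1 _ h C X hX)
      · exact absurd rfl (hK.2.2 _ h C X hX)

/-- The context of a conjunct of `conj1`. -/
theorem exists_fill_eq_conj1 (l r : List CL2) :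
    ∃ K : SCtx, K.negCount = 0 ∧ (∀ F, K.fill F = conj1 (l ++ F :: r)) ∧
      ((∀ F ∈ l ++ r, F.ChoiceFree) → K.ChoiceFree) := by
  by_cases h : l = [] ∧ r = []
  · obtain ⟨rfl, rfl⟩ := h
    exact ⟨hole, rfl, fun _ => rfl, fun _ => trivial⟩
  · refine ⟨land l hole r, rfl, fun F => ?_, fun hF => ⟨?_, trivial, ?_⟩⟩
    · rcases l with _ | ⟨x, _ | ⟨y, l⟩⟩ <;> rcases r with _ | ⟨z, r⟩ <;> simp_all [fill, conj1]
    all_goals exact fun F h => hF F (by simp [h])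

end SCtx

/-- `A → t` follows from any hypotheses that include it, where `A` is a conjunction of
elementary atoms followed by general ones. -/
theorem Provable.imp_conj1_elem (L r : List CL2) (hL : ∀ F ∈ L, F.ChoiceFree)
    (hr : ∀ F ∈ r, F.ChoiceFree) (t : Nat) (xs ys : List Nat) :
    Provable (CL2.imp
      (CL2.land (L ++ CL2.imp (conj1 (ys.map CL2.elem ++ xs.map CL2.gen)) (CL2.elem t) :: r))
      (CL2.imp (conj1 (ys.map CL2.elem ++ xs.map CL2.gen)) (CL2.elem t))) := by
  induction xs generalizing ys with
  | nil =>
    have hA : (CL2.imp (conj1 (ys.map CL2.elem ++ [].map CL2.gen)) (CL2.elem t)).ChoiceFree :=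
      .imp (.conj1 (by simpa using fun a _ => CL2.choiceFree_elem a)) (CL2.choiceFree_elem t)
    refine .ruleA _ (fun v => ?_) fun H hH => absurd hH (CL2.ChoiceFree.not_premiseA
      (.imp (.land fun F hF => ?_) hA))
    · simp only [CL2.imp, CL2.elz_lor, CL2.elz_land, CL2.elz, List.map_cons, List.map_nil,
        CL2.eval_lor, CL2.eval_land, CL2.eval, List.any_cons, List.any_nil, List.map_append,
        List.all_append, List.all_cons, CL2.eval_elz_conj1, List.append_nil, List.all_map,
        Function.comp_def, Bool.or_false]
      generalize ys.all (fun x => v x) = a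
      generalize v t = b
      cases a <;> cases b <;> simp
    · rcases List.mem_append.1 hF with h | h
      · exact hL F h
      · rcases List.mem_cons.1 h with rfl | h
        · exact hA
        · exact hr F h
  | cons x xs ih =>
    obtain ⟨K, hK, hfill, -⟩ := SCtx.exists_fill_eq_conj1 (ys.map CL2.elem) (xs.map CL2.gen)
    obtain ⟨p, hp⟩ := CL2.exists_elemOccurs_eq_false (CL2.imp
      (CL2.land (L ++ CL2.imp (conj1 (ys.map CL2.elem ++ (x :: xs).map CL2.gen)) (CL2.elem t) :: r))
      (CL2.imp (conj1 (ys.map CL2.elem ++ (x :: xs).map CL2.gen)) (CL2.elem t)))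
    refine .ruleC _ _ ⟨.lorS [] (.neg (.land L (.lor [] (.neg K) [CL2.elem t]) r)) []
      (.lor [] (.neg K) [CL2.elem t]) [], x, p, ?_, rfl, .inl ?_, hp⟩ ?_
    · simp [DCtx.fill2, SCtx.fill, hfill, CL2.imp]
    · simp [DCtx.negCount1, DCtx.negCount2, SCtx.negCount, hK]
    · simpa [DCtx.fill2, SCtx.fill, hfill, CL2.imp] using ih (ys ++ [p])

/-- `A → T` follows from any hypotheses that include it, where `A` is a conjunction of
general atoms. -/
theorem Provable.imp_conj1_gen (L r : List CL2) (hL : ∀ F ∈ L, F.ChoiceFree)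
    (hr : ∀ F ∈ r, F.ChoiceFree) (T : Nat) (xs : List Nat) :
    Provable (CL2.imp
      (CL2.land (L ++ CL2.imp (conj1 (xs.map CL2.gen)) (CL2.gen T) :: r))
      (CL2.imp (conj1 (xs.map CL2.gen)) (CL2.gen T))) := by
  obtain ⟨p, hp⟩ := CL2.exists_elemOccurs_eq_false (CL2.imp
    (CL2.land (L ++ CL2.imp (conj1 (xs.map CL2.gen)) (CL2.gen T) :: r))
    (CL2.imp (conj1 (xs.map CL2.gen)) (CL2.gen T)))
  refine .ruleC _ _ ⟨.lorS [] (.neg (.land L (.lor [(conj1 (xs.map CL2.gen)).neg] .hole []) r)) []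
    (.lor [(conj1 (xs.map CL2.gen)).neg] .hole []) [], T, p, ?_, rfl, .inr ?_, hp⟩ ?_
  · simp [DCtx.fill2, SCtx.fill, CL2.imp]
  · simp [DCtx.negCount1, DCtx.negCount2, SCtx.negCount]
  · simpa [DCtx.fill2, SCtx.fill, CL2.imp] using
      Provable.imp_conj1_elem L r hL hr p xs []

/-- Lemma 8(i): for all n ≥ 2, m ≥ 0 and pairwise distinct general atoms
R₁,…,R_m, S₁,…,Sₙ, T, the formula
(R₁∧…∧R_m∧S₁ → T) ∧ … ∧ (R₁∧…∧R_m∧Sₙ → T) → (R₁∧…∧R_m∧(S₁⊔…⊔Sₙ) → T)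
is provable in CL2. -/
theorem cl2_provable_i (n m : Nat) (hn : 2 ≤ n) (R : Fin m → Nat) (S : Fin n → Nat)
    (T : Nat) (hdist : (List.ofFn R ++ List.ofFn S ++ [T]).Nodup) :
    Provable (CL2.imp
      (CL2.land (List.ofFn fun i =>
        conjImp ((List.ofFn R).map CL2.gen ++ [CL2.gen (S i)]) (CL2.gen T)))
      (conjImp ((List.ofFn R).map CL2.gen ++ [CL2.chor ((List.ofFn S).map CL2.gen)])
        (CL2.gen T))) := by
  simp only [conjImp_append_singleton]
  set A : List CL2 := (List.ofFn R).map CL2.gen with hA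
  set hyps : List CL2 := List.ofFn fun i => CL2.imp (conj1 (A ++ [CL2.gen (S i)])) (CL2.gen T)
    with hhyps
  have hAfree : ∀ F ∈ A, F.ChoiceFree := by
    simp only [hA, List.mem_map]
    rintro _ ⟨a, -, rfl⟩
    exact CL2.choiceFree_gen a
  have hfree : ∀ F ∈ hyps, F.ChoiceFree := by
    simp only [hhyps, List.mem_ofFn]
    rintro _ ⟨i, rfl⟩
    refine .imp (.conj1 fun F hF => ?_) (CL2.choiceFree_gen T)
    rcases List.mem_append.1 hF with h | h
    · exact hAfree F h
    · rw [List.mem_singleton.1 h]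
      exact CL2.choiceFree_gen _
  obtain ⟨K, -, hfill, hKfree⟩ := SCtx.exists_fill_eq_conj1 A []
  let C₀ : SCtx := .lor [(CL2.land hyps).neg] (.lor [] (.neg K) [CL2.gen T]) []
  have hC₀ : C₀.ChoiceFree := by
    refine ⟨?_, ⟨by simp, hKfree (by simpa using hAfree), ?_⟩, by simp⟩
    · simpa using (CL2.ChoiceFree.land hfree).neg
    · simpa using CL2.choiceFree_gen T
  have hfill₀ (F : CL2) : C₀.fill F =
      CL2.imp (CL2.land hyps) (CL2.imp (conj1 (A ++ [F])) (CL2.gen T)) := by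
    simp [C₀, SCtx.fill, hfill, CL2.imp]
  refine .ruleA _ (fun v => ?_) ?_
  · simp [CL2.imp, CL2.elz, CL2.eval, CL2.eval_elz_conj1]
  · rw [← hfill₀]
    rintro H ⟨C, Gs, i, ⟨-, h, -⟩ | ⟨-, h, rfl⟩⟩
    · simpa using (hC₀.fill_injective (.inl ⟨_, rfl⟩) (.inr ⟨_, rfl⟩) h).2
    · obtain ⟨rfl, hGs⟩ := hC₀.fill_injective (.inr ⟨_, rfl⟩) (.inr ⟨_, rfl⟩) h
      obtain ⟨k, hk⟩ : ∃ k, CL2.gen (S k) = Gs.get i := by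
        have hmem : Gs.get i ∈ (List.ofFn S).map CL2.gen := CL2.chor.inj hGs ▸ Gs.get_mem i
        simpa [List.mem_ofFn] using hmem
      have hmem : CL2.imp (conj1 (A ++ [CL2.gen (S k)])) (CL2.gen T) ∈ hyps :=
        List.mem_ofFn.2 ⟨k, rfl⟩
      obtain ⟨L, r, hLr⟩ := List.append_of_mem hmem
      rw [← hk, hfill₀, hLr]
      simpa [hA] using Provable.imp_conj1_gen L r (fun F h => hfree F (by simp [hLr, h]))
        (fun F h => hfree F (by simp [hLr, h])) T (List.ofFn R ++ [S k])
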